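/- Let P be a submonoid of a group G and let p₁, q₁, …, p_n, q_n ∈ P satisfy p₁⁻¹q₁ ⋯ p_n⁻¹q_n = e, the product being computed in the group G. Then V_{p₁}* V_{q₁} ⋯ V_{p_n}* V_{q_n} = E_{[q_n⁻¹p_n ⋯ q₁⁻¹p₁ P]} as bounded operators on ℓ²(P); in particular this product of operators is an orthogonal projection. -/

import Mathlib

noncomputable section

open ContinuousLinearMap
open scoped Classical

variable {G : Type*} [Group G]

/-- The Hilbert space ℓ²(P). -/
abbrev l2 (P : Submonoid G) : Type _ := lp (fun _ : P => ℂ) 2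

/-- The standard orthonormal basis vector δ_s of ℓ²(P). -/
def delta (P : Submonoid G) (s : P) : l2 P :=
  letI := Classical.decEq P
  lp.single 2 s 1

/-- The set pX = {px : x ∈ X}. -/
def lmul (P : Submonoid G) (p : P) (X : Set P) : Set P := (fun x => p * x) '' X

/-- The set p⁻¹X = {y ∈ P : py ∈ X}. -/
def linv (P : Submonoid G) (p : P) (X : Set P) : Set P := {y : P | p * y ∈ X}

/-- The set p₁⁻¹q₁ ⋯ pₙ⁻¹qₙ X, the operations being applied iteratively from the right;
the word is encoded as the list [(p₁,q₁),…,(pₙ,qₙ)]. -/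
def wordSet (P : Submonoid G) (l : List (P × P)) (X : Set P) : Set P :=
  l.foldr (fun a Y => linv P a.1 (lmul P a.2 Y)) X

/-- The operator V_{p₁}* V_{q₁} ⋯ V_{pₙ}* V_{qₙ} on ℓ²(P), the word being encoded as the
list [(p₁,q₁),…,(pₙ,qₙ)]. -/
def opWord (P : Submonoid G) (V : P → (l2 P →L[ℂ] l2 P)) (l : List (P × P)) :
    l2 P →L[ℂ] l2 P :=
  (l.map fun a => (ContinuousLinearMap.adjoint (V a.1)) * (V a.2)).prod

/-- The group element p₁⁻¹q₁ ⋯ pₙ⁻¹qₙ of G. -/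
def grpWord (P : Submonoid G) (l : List (P × P)) : G :=
  (l.map fun a => ((a.1 : G))⁻¹ * (a.2 : G)).prod


theorem delta_apply {P : Submonoid G} (s t : P) :
    (delta P s : P → ℂ) t = if t = s then 1 else 0 := by
  simp [delta, lp.single_apply, Pi.single_apply]

/-- Continuous linear maps on ℓ²(P) agreeing on the standard basis are equal. -/
theorem clm_ext_delta {P : Submonoid G} {S T : l2 P →L[ℂ] l2 P}
    (h : ∀ s, S (delta P s) = T (delta P s)) : S = T := by
  ext1 f
  have hf := lp.hasSum_single (E := fun _ : P => ℂ) (p := 2) (by norm_num) f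
  have key : ∀ s : P, lp.single (E := fun _ : P => ℂ) 2 s (f s) = f s • delta P s := by
    intro s
    ext t
    by_cases h : t = s
    · subst h
      simp [delta_apply]
    · simp [delta_apply, h]
  simp only [key] at hf
  refine (hf.mapL S).unique ?_
  simpa [h] using hf.mapL T

theorem inner_delta_left {P : Submonoid G} (s : P) (f : l2 P) :
    inner ℂ (delta P s) f = f s := by
  simp [delta, lp.inner_single_left]

theorem ext_inner_delta {P : Submonoid G} {f g : l2 P}
    (h : ∀ s, inner ℂ (delta P s) f = inner ℂ (delta P s) g) : f = g := by
  ext s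
  simpa [inner_delta_left] using h s

theorem adjoint_apply_delta_mul {P : Submonoid G} {V : P → (l2 P →L[ℂ] l2 P)}
    (hV : ∀ p s : P, V p (delta P s) = delta P (p * s)) (p r : P) :
    adjoint (V p) (delta P (p * r)) = delta P r := by
  refine ext_inner_delta fun s => ?_
  simp [adjoint_inner_right, hV, inner_delta_left, delta_apply]

theorem adjoint_apply_delta_of_forall_ne {P : Submonoid G} {V : P → (l2 P →L[ℂ] l2 P)}
    (hV : ∀ p s : P, V p (delta P s) = delta P (p * s)) {p t : P} (h : ∀ r, p * r ≠ t) :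
    adjoint (V p) (delta P t) = 0 := by
  refine ext_inner_delta fun s => ?_
  simp [adjoint_inner_right, hV, inner_delta_left, delta_apply, h]

/-- A word of operators acts on the basis as the partial bijection of P given by left
translation by the group element of the word. -/
theorem opWord_apply_delta {P : Submonoid G} {V : P → (l2 P →L[ℂ] l2 P)}
    (hV : ∀ p s : P, V p (delta P s) = delta P (p * s)) (l : List (P × P)) (s : P) :
    (s ∈ wordSet P (l.map Prod.swap).reverse Set.univ →
      ∃ t : P, (t : G) = grpWord P l * s ∧ opWord P V l (delta P s) = delta P t) ∧
    (s ∉ wordSet P (l.map Prod.swap).reverse Set.univ → opWord P V l (delta P s) = 0) := by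
  induction l using List.reverseRecOn generalizing s with
  | nil => simp [wordSet, opWord, grpWord]
  | append_singleton l a ih =>
    obtain ⟨p, q⟩ := a
    have hset : wordSet P ((l ++ [(p, q)]).map Prod.swap).reverse Set.univ =
        linv P q (lmul P p (wordSet P (l.map Prod.swap).reverse Set.univ)) := by
      simp [wordSet]
    have hop : opWord P V (l ++ [(p, q)]) (delta P s) =
        opWord P V l (adjoint (V p) (delta P (q * s))) := by
      simp [opWord, hV]
    have hgrp : grpWord P (l ++ [(p, q)]) = grpWord P l * ((p : G)⁻¹ * q) := by
      simp [grpWord]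
    rw [hset, hop, hgrp]
    constructor
    · rintro ⟨r, hr, hrs⟩
      simp only at hrs
      rw [← hrs, adjoint_apply_delta_mul hV]
      obtain ⟨t, ht, hop⟩ := (ih r).1 hr
      refine ⟨t, ?_, hop⟩
      have hG : (p : G) * r = q * s := congrArg Subtype.val hrs
      rw [ht, mul_assoc, mul_assoc, ← hG, inv_mul_cancel_left]
    · intro hs
      by_cases h : ∃ r, p * r = q * s
      · obtain ⟨r, hr⟩ := h
        rw [← hr, adjoint_apply_delta_mul hV]
        exact (ih r).2 fun hmem => hs ⟨r, hmem, hr⟩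
      · push Not at h
        rw [adjoint_apply_delta_of_forall_ne hV h, map_zero]

theorem isSelfAdjoint_of_apply_delta {P : Submonoid G} {T : l2 P →L[ℂ] l2 P} {X : Set P}
    (hT : ∀ s, T (delta P s) = if s ∈ X then delta P s else 0) : IsSelfAdjoint T := by
  rw [isSelfAdjoint_iff']
  refine clm_ext_delta fun s => ext_inner_delta fun t => ?_
  rw [adjoint_inner_right, hT, hT]
  by_cases hst : t = s
  · subst hst
    split_ifs <;> simp
  · split_ifs <;> simp [inner_delta_left, delta_apply, hst]

theorem isIdempotentElem_of_apply_delta {P : Submonoid G} {T : l2 P →L[ℂ] l2 P} {X : Set P}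
    (hT : ∀ s, T (delta P s) = if s ∈ X then delta P s else 0) : IsIdempotentElem T := by
  refine clm_ext_delta fun s => ?_
  rw [mul_apply_eq_comp, hT]
  split_ifs with h
  · rw [hT, if_pos h]
  · rw [map_zero]

/-- If p₁⁻¹q₁ ⋯ pₙ⁻¹qₙ = e in G, then
V_{p₁}* V_{q₁} ⋯ V_{pₙ}* V_{qₙ} = E_{[qₙ⁻¹pₙ ⋯ q₁⁻¹p₁ P]}; in particular this product
of operators is an orthogonal projection. -/
theorem stmt5 (P : Submonoid G)
    (V : P → (l2 P →L[ℂ] l2 P)) (E : Set P → (l2 P →L[ℂ] l2 P))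
    (hV : ∀ p s : P, V p (delta P s) = delta P (p * s))
    (hE : ∀ (X : Set P) (s : P), E X (delta P s) = if s ∈ X then delta P s else 0)
    (n : ℕ) (p q : Fin n → P)
    (hprod : grpWord P (List.ofFn fun i => (p i, q i)) = 1) :
    opWord P V (List.ofFn fun i => (p i, q i))
        = E (wordSet P ((List.ofFn fun i => (q i, p i)).reverse) Set.univ)
      ∧ IsSelfAdjoint (opWord P V (List.ofFn fun i => (p i, q i)))
      ∧ IsIdempotentElem (opWord P V (List.ofFn fun i => (p i, q i))) := by
  have hswap : (List.ofFn fun i => (q i, p i)) =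
      (List.ofFn fun i => (p i, q i)).map Prod.swap := by
    rw [List.map_ofFn]
    rfl
  rw [hswap]
  generalize (List.ofFn fun i => (p i, q i)) = l at hprod ⊢
  have h : opWord P V l = E (wordSet P (l.map Prod.swap).reverse Set.univ) := by
    refine clm_ext_delta fun s => ?_
    rw [hE]
    split_ifs with hs
    · obtain ⟨t, ht, hop⟩ := (opWord_apply_delta hV l s).1 hs
      rw [hprod, one_mul] at ht
      rw [hop, Subtype.ext ht]
    · exact (opWord_apply_delta hV l s).2 hs
  rw [h]
  exact ⟨rfl, isSelfAdjoint_of_apply_delta (hE _), isIdempotentElem_of_apply_delta (hE _)⟩
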